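/- arXiv:math/0008219 — 4 statements merged into one kernel-verified Lean document; each statement's English description precedes it below -/
import Mathlib

section
/- Let n ≥ 2 and identify ℝ^{2n−2} with ℂ^{n−1} carrying the standard action of U_{n−1}. If J : ℝ^{2n−2} → ℝ^{2n−2} is a real-linear map with J² = −id that commutes with the action of every element of U_{n−1}, then J is either multiplication by i or multiplication by −i. In other words, there exist exactly two U_{n−1}-invariant complex linear space structures on ℝ^{2n−2}: the standard one and its conjugate. -/
open Matrix

noncomputable section

/-- The unitary group `U_m`. -/
abbrev UGrp (m : ℕ) := Matrix.unitaryGroup (Fin m) ℂ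

/-- A real-linear map commuting with the unitary group is complex linear. -/
theorem map_smul_of_comm_unitary {m : ℕ} (J : (Fin m → ℂ) →ₗ[ℝ] (Fin m → ℂ))
    (hcomm : ∀ (A : UGrp m) (v : Fin m → ℂ),
      J ((A : Matrix (Fin m) (Fin m) ℂ) *ᵥ v) = (A : Matrix (Fin m) (Fin m) ℂ) *ᵥ J v)
    (z : ℂ) (v : Fin m → ℂ) : J (z • v) = z • J v := by
  have hmem : Complex.I • (1 : Matrix (Fin m) (Fin m) ℂ) ∈ Matrix.unitaryGroup (Fin m) ℂ := by
    rw [Matrix.mem_unitaryGroup_iff]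
    simp [star_smul, smul_smul]
  have hI : J (Complex.I • v) = Complex.I • J v := by
    simpa [Matrix.smul_mulVec] using hcomm ⟨_, hmem⟩ v
  have hz (w : Fin m → ℂ) : z • w = z.re • w + z.im • (Complex.I • w) := by
    ext k
    simp only [Pi.smul_apply, Pi.add_apply, smul_eq_mul, Complex.real_smul]
    conv_lhs => rw [← Complex.re_add_im z]
    ring
  rw [hz v, hz (J v), map_add, map_smul, map_smul, hI]

/-- A real-linear map commuting with the unitary group acts diagonally on coordinates. -/
theorem apply_eq_mul_of_comm_unitary {m : ℕ} (J : (Fin m → ℂ) →ₗ[ℝ] (Fin m → ℂ))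
    (hcomm : ∀ (A : UGrp m) (v : Fin m → ℂ),
      J ((A : Matrix (Fin m) (Fin m) ℂ) *ᵥ v) = (A : Matrix (Fin m) (Fin m) ℂ) *ᵥ J v)
    (v : Fin m → ℂ) (k : Fin m) : J v k = v k * J (Pi.single k 1) k := by
  set d : Fin m → ℂ := fun i => if i = k then 1 else -1 with hd
  have hmem : Matrix.diagonal d ∈ Matrix.unitaryGroup (Fin m) ℂ := by
    rw [Matrix.mem_unitaryGroup_iff, Matrix.star_eq_conjTranspose,
      Matrix.diagonal_conjTranspose, Matrix.diagonal_mul_diagonal, ← Matrix.diagonal_one]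
    congr 1
    ext i
    by_cases h : i = k <;> simp [hd, h]
  have hv : v + Matrix.diagonal d *ᵥ v = (2 * v k) • Pi.single k (1 : ℂ) := by
    ext i
    by_cases h : i = k
    · subst h
      simp [Matrix.mulVec_diagonal, hd]
      ring
    · simp [Matrix.mulVec_diagonal, hd, h]
  have h := congrFun (congrArg J hv) k
  rw [map_add, hcomm ⟨_, hmem⟩ v, map_smul_of_comm_unitary J hcomm] at h
  simp only [Pi.add_apply, Matrix.mulVec_diagonal, hd, if_true, Pi.smul_apply,
    smul_eq_mul] at h
  linear_combination h / 2

/-- A real-linear map commuting with the unitary group is a complex scalar. -/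
theorem exists_eq_smul_of_comm_unitary {m : ℕ} (J : (Fin m → ℂ) →ₗ[ℝ] (Fin m → ℂ))
    (hcomm : ∀ (A : UGrp m) (v : Fin m → ℂ),
      J ((A : Matrix (Fin m) (Fin m) ℂ) *ᵥ v) = (A : Matrix (Fin m) (Fin m) ℂ) *ᵥ J v)
    (k : Fin m) : ∃ c : ℂ, ∀ v, J v = c • v := by
  refine ⟨J 1 k, fun v => ?_⟩
  ext i
  have hmem : (Equiv.swap i k).permMatrix ℂ ∈ Matrix.unitaryGroup (Fin m) ℂ := by
    rw [Matrix.mem_unitaryGroup_iff, Matrix.star_eq_conjTranspose,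
      Matrix.conjTranspose_permMatrix, ← Matrix.permMatrix_mul]
    simp
  have h := congrFun (hcomm ⟨_, hmem⟩ 1) i
  simp only [Matrix.permMatrix_mulVec] at h
  have h1 : (1 : Fin m → ℂ) ∘ Equiv.swap i k = 1 := rfl
  rw [h1, Function.comp_apply, Equiv.swap_apply_left] at h
  rw [Pi.smul_apply, ← h, apply_eq_mul_of_comm_unitary J hcomm v i,
    apply_eq_mul_of_comm_unitary J hcomm 1 i, Pi.one_apply, one_mul, smul_eq_mul, mul_comm]

/-- Identify `ℝ^{2n−2}` with `ℂ^{n−1}` carrying the standard action of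
`U_{n−1}`. If `J` is a real-linear map with `J² = −id` commuting with the action of every
element of `U_{n−1}`, then `J` is either multiplication by `i` or multiplication by `−i`:
there are exactly two `U_{n−1}`-invariant complex structures, the standard one and its
conjugate. -/
theorem invariant_complex_structure {n : ℕ} (hn : 2 ≤ n)
    (J : (Fin (n - 1) → ℂ) →ₗ[ℝ] (Fin (n - 1) → ℂ))
    (hJ2 : ∀ v, J (J v) = -v)
    (hcomm : ∀ (A : UGrp (n - 1)) (v : Fin (n - 1) → ℂ),
      J ((A : Matrix (Fin (n - 1)) (Fin (n - 1)) ℂ) *ᵥ v)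
        = (A : Matrix (Fin (n - 1)) (Fin (n - 1)) ℂ) *ᵥ (J v)) :
    (∀ v, J v = Complex.I • v) ∨ (∀ v, J v = (-Complex.I) • v) := by
  obtain ⟨c, hc⟩ := exists_eq_smul_of_comm_unitary J hcomm ⟨0, by omega⟩
  have h2 : c * c = Complex.I * Complex.I := by
    have h := congrFun (hJ2 1) ⟨0, by omega⟩
    rw [hc, hc] at h
    simpa using h
  rcases mul_self_eq_mul_self_iff.mp h2 with rfl | rfl
  · exact Or.inl hc
  · exact Or.inr hc

end
end

section
/- Let n ≥ 2 and embed U_{n−1} in Aut(ℂ^n) by letting a unitary matrix act on the last n−1 coordinates z' = (z₂,…,z_n) while fixing z₁. Then the centralizer C of U_{n−1} in Aut(ℂ^n) consists exactly of the maps f = (f₁, f') of the form f₁(z₁,z') = a z₁ + b, f'(z₁,z') = h(z₁) z', where a, b ∈ ℂ, a ≠ 0, and h is a nowhere-vanishing entire function of one complex variable. -/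
open Matrix

noncomputable section

/-- `ℂ^n`, written as `ℂ × ℂ^{n-1}` to display the coordinate splitting
`z = (z₁, z')`. -/
abbrev WSp (n : ℕ) : Type := ℂ × (Fin (n - 1) → ℂ)

/-- The group `Aut(ℂ^n)` of biholomorphic automorphisms of `ℂ^n`, as a subgroup of the
permutation group. -/
def autCn (n : ℕ) : Subgroup (Equiv.Perm (WSp n)) where
  carrier := {f | Differentiable ℂ ⇑f ∧ Differentiable ℂ ⇑f.symm}
  one_mem' := ⟨differentiable_id, differentiable_id⟩
  mul_mem' := by
    rintro f g ⟨hf, hf'⟩ ⟨hg, hg'⟩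
    exact ⟨hf.comp hg, hg'.comp hf'⟩
  inv_mem' := by
    rintro f ⟨hf, hf'⟩
    exact ⟨hf', hf⟩

/-- The copy of `U_{n-1}` inside `Aut(ℂ^n)`: a unitary matrix `B` acts on the last `n−1`
coordinates `z' = (z₂,…,z_n)` and fixes `z₁`. -/
def unitarySet (n : ℕ) : Set (autCn n) :=
  {f | ∃ B : UGrp (n - 1), ∀ p : WSp n,
    (f : Equiv.Perm (WSp n)) p = (p.1, (B : Matrix (Fin (n - 1)) (Fin (n - 1)) ℂ) *ᵥ p.2)}

/-- An entire function of at most linear growth is affine. -/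
theorem exists_affine_of_linear_growth {q : ℂ → ℂ} (hq : Differentiable ℂ q) {C : ℝ}
    (hC : ∀ z, ‖q z‖ ≤ C * (1 + ‖z‖)) : ∃ a b : ℂ, ∀ z, q z = a * z + b := by
  have hC0 : 0 ≤ C := by simpa using (norm_nonneg _).trans (hC 0)
  have hbound : ∀ z, ‖deriv q z‖ ≤ 2 * C := by
    intro z
    have hR : 0 < 1 + ‖z‖ := by positivity
    have h := Complex.norm_deriv_le_of_forall_mem_sphere_norm_le (c := z) (f := q)
      (C := 2 * C * (1 + ‖z‖)) hR hq.diffContOnCl (fun w hw => by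
        have hw' : ‖w‖ ≤ ‖z‖ + (1 + ‖z‖) := by
          rw [mem_sphere_iff_norm] at hw
          calc ‖w‖ = ‖z + (w - z)‖ := by simp
            _ ≤ ‖z‖ + ‖w - z‖ := norm_add_le _ _
            _ = _ := by rw [hw]
        refine (hC w).trans ?_
        nlinarith)
    rwa [mul_div_assoc, div_self hR.ne', mul_one] at h
  have hdiff : Differentiable ℂ (deriv q) := fun z =>
    (hq.analyticAt z).deriv.differentiableAt
  have hbdd : Bornology.IsBounded (Set.range (deriv q)) :=
    isBounded_iff_forall_norm_le.2 ⟨2 * C, by rintro _ ⟨z, rfl⟩; exact hbound z⟩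
  have hconst : ∀ z, deriv q z = deriv q 0 := fun z =>
    hdiff.apply_eq_apply_of_bounded hbdd z 0
  refine ⟨deriv q 0, q 0, fun z => ?_⟩
  have hz : ∀ w, HasDerivAt (fun x => q x - deriv q 0 * x) 0 w := fun w => by
    have := (hq w).hasDerivAt.sub ((hasDerivAt_id w).const_mul (deriv q 0))
    rw [mul_one, hconst w, sub_self] at this
    exact this
  have := is_const_of_deriv_eq_zero (fun w => (hz w).differentiableAt)
    (fun w => (hz w).deriv) z 0
  linear_combination this

/-- A biholomorphic automorphism of `ℂ` is affine. -/
theorem exists_affine_of_entire_inverse {g G : ℂ → ℂ} (hg : Differentiable ℂ g)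
    (hG : Differentiable ℂ G) (hgG : ∀ z, g (G z) = z) (hGg : ∀ z, G (g z) = z) :
    ∃ a b : ℂ, a ≠ 0 ∧ ∀ z, g z = a * z + b := by
  set z₀ := G 0 with hz₀
  have hgz₀ : g z₀ = 0 := hgG 0
  have hg0 : ∀ z, g z = 0 → z = z₀ := fun z hz => by rw [← hGg z, hz]
  have hderiv : deriv g z₀ ≠ 0 := by
    intro h0
    have hc := (hG (g z₀)).hasDerivAt.comp z₀ (hg z₀).hasDerivAt
    have hid : G ∘ g = id := funext hGg
    rw [hid, h0, mul_zero] at hc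
    exact zero_ne_one (hc.unique (hasDerivAt_id z₀))
  have hslope : ∀ z, (z - z₀) * dslope g z₀ z = g z := fun z => by
    have := sub_smul_dslope g z₀ z
    rwa [smul_eq_mul, hgz₀, sub_zero] at this
  have hs0 : ∀ z, dslope g z₀ z ≠ 0 := by
    intro z hz
    by_cases h : z = z₀
    · rw [h, dslope_same] at hz
      exact hderiv hz
    · exact h (hg0 z (by rw [← hslope z, hz, mul_zero]))
  have hsd : Differentiable ℂ (dslope g z₀) := by
    rw [← differentiableOn_univ]
    exact (Complex.differentiableOn_dslope Filter.univ_mem).2 hg.differentiableOn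
  have hqd : Differentiable ℂ (fun z => (dslope g z₀ z)⁻¹) := fun z => (hsd z).inv (hs0 z)
  have hcomp : IsCompact (G '' Metric.closedBall 0 1) :=
    (isCompact_closedBall 0 1).image hG.continuous
  obtain ⟨M, hM⟩ := hcomp.exists_bound_of_continuousOn hqd.continuous.continuousOn
  have hM0 : 0 ≤ M := (norm_nonneg _).trans (hM z₀ ⟨0, by simp, rfl⟩)
  obtain ⟨a, b, hab⟩ := exists_affine_of_linear_growth hqd (C := M + 1 + ‖z₀‖) (fun z => by
    have hzn := norm_nonneg z
    have hz₀n := norm_nonneg z₀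
    by_cases h : ‖g z‖ ≤ 1
    · have := hM z ⟨g z, by simpa using h, hGg z⟩
      nlinarith [mul_nonneg hM0 hzn, mul_nonneg hz₀n hzn]
    · push Not at h
      have hgne : g z ≠ 0 := fun h0 => by rw [h0, norm_zero] at h; linarith
      have hq : (dslope g z₀ z)⁻¹ = (z - z₀) / g z := by
        rw [eq_div_iff hgne, ← hslope z]
        field_simp [hs0 z]
      rw [hq, norm_div]
      have h1 : ‖z - z₀‖ / ‖g z‖ ≤ ‖z - z₀‖ := div_le_self (norm_nonneg _) h.le
      have h2 := norm_sub_le z z₀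
      nlinarith [mul_nonneg hM0 hzn, mul_nonneg hz₀n hzn])
  have ha : a = 0 := by
    by_contra ha
    have := hab (-b / a)
    rw [mul_div_cancel₀ _ ha, neg_add_cancel] at this
    exact inv_ne_zero (hs0 _) this
  have hb : ∀ z, dslope g z₀ z = b⁻¹ := fun z => by
    have := hab z
    rw [ha, zero_mul, zero_add] at this
    rw [← this, inv_inv]
  refine ⟨b⁻¹, -b⁻¹ * z₀, hb 0 ▸ hs0 0, fun z => ?_⟩
  rw [← hslope z, hb z]
  ring

/-- Two entire functions which agree on the unit circle are equal. -/
theorem eq_of_eqOn_unit_circle {E : Type*} [NormedAddCommGroup E] [NormedSpace ℂ E]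
    [CompleteSpace E] {φ ψ : ℂ → E} (hφ : Differentiable ℂ φ) (hψ : Differentiable ℂ ψ)
    (h : ∀ c : ℂ, ‖c‖ = 1 → φ c = ψ c) : φ = ψ := by
  have hball : Set.EqOn φ ψ (Metric.ball 0 1) :=
    Complex.eqOn_of_eqOn_frontier Metric.isBounded_ball hφ.diffContOnCl hψ.diffContOnCl
      (fun c hc => h c (by
        rw [frontier_ball _ one_ne_zero] at hc
        simpa using hc))
  exact AnalyticOnNhd.eq_of_eventuallyEq (z₀ := 0) (fun z _ => hφ.analyticAt z)
    (fun z _ => hψ.analyticAt z)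
    (Filter.eventually_of_mem (Metric.ball_mem_nhds _ one_pos) hball)

/-- An entire map which is equivariant under multiplication by the unit circle is linear. -/
theorem exists_linear_of_circle_equivariant {E F : Type*} [NormedAddCommGroup E]
    [NormedSpace ℂ E] [NormedAddCommGroup F] [NormedSpace ℂ F] [CompleteSpace F] {φ : E → F}
    (hφ : Differentiable ℂ φ) (h : ∀ c : ℂ, ‖c‖ = 1 → ∀ v, φ (c • v) = c • φ v) :
    ∃ A : E →L[ℂ] F, ∀ v, φ v = A v := by
  refine ⟨fderiv ℂ φ 0, fun v => ?_⟩
  have hlin : (fun c : ℂ => φ (c • v)) = fun c => c • φ v :=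
    eq_of_eqOn_unit_circle (hφ.comp (differentiable_id.smul_const v))
      (differentiable_id.smul_const _) (fun c hc => h c hc v)
  have hline : HasDerivAt (fun c : ℂ => c • v) v 0 := by
    simpa using (hasDerivAt_id (0 : ℂ)).smul_const v
  have hφ0 : HasFDerivAt φ (fderiv ℂ φ 0) ((0 : ℂ) • v) := by
    rw [zero_smul]
    exact (hφ 0).hasFDerivAt
  have h1 : HasDerivAt (fun c : ℂ => φ (c • v)) (fderiv ℂ φ 0 v) 0 :=
    hφ0.comp_hasDerivAt 0 hline
  have h2 : HasDerivAt (fun c : ℂ => c • φ v) (φ v) 0 := by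
    simpa using (hasDerivAt_id (0 : ℂ)).smul_const (φ v)
  rw [hlin] at h1
  exact h2.unique h1

/-- An entire map which is invariant under multiplication by the unit circle is constant. -/
theorem eq_apply_zero_of_circle_invariant {E F : Type*} [NormedAddCommGroup E]
    [NormedSpace ℂ E] [NormedAddCommGroup F] [NormedSpace ℂ F] [CompleteSpace F] {φ : E → F}
    (hφ : Differentiable ℂ φ) (h : ∀ c : ℂ, ‖c‖ = 1 → ∀ v, φ (c • v) = φ v) (v : E) :
    φ v = φ 0 := by
  have hconst : (fun c : ℂ => φ (c • v)) = fun _ => φ v :=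
    eq_of_eqOn_unit_circle (hφ.comp (differentiable_id.smul_const v))
      (differentiable_const _) (fun c hc => h c hc v)
  simpa using (congrFun hconst 0).symm

/-- A diagonal matrix with entries on the unit circle, as an element of the unitary group. -/
def diagonalUnitary {m : ℕ} (d : Fin m → ℂ) (hd : ∀ i, ‖d i‖ = 1) : UGrp m :=
  ⟨Matrix.diagonal d, by
    rw [Matrix.mem_unitaryGroup_iff, Matrix.star_eq_conjTranspose,
      Matrix.diagonal_conjTranspose, Matrix.diagonal_mul_diagonal, ← Matrix.diagonal_one]
    congr 1
    ext i
    simp [Complex.mul_conj, Complex.normSq_eq_norm_sq, hd i]⟩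

/-- A permutation matrix, as an element of the unitary group. -/
def permUnitary {m : ℕ} (σ : Equiv.Perm (Fin m)) : UGrp m :=
  ⟨σ.permMatrix ℂ, by
    rw [Matrix.mem_unitaryGroup_iff, Matrix.star_eq_conjTranspose,
      Matrix.conjTranspose_permMatrix, ← Matrix.permMatrix_mul]
    simp⟩

/-- A linear map commuting with the unitary group is scalar. -/
theorem eq_smul_of_commute_unitary {m : ℕ} (A : (Fin m → ℂ) →ₗ[ℂ] (Fin m → ℂ))
    (hA : ∀ (B : UGrp m) (v : Fin m → ℂ),
      A ((B : Matrix (Fin m) (Fin m) ℂ) *ᵥ v) = (B : Matrix (Fin m) (Fin m) ℂ) *ᵥ A v)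
    (k : Fin m) (v : Fin m → ℂ) : A v = A (Pi.single k 1) k • v := by
  have hoff : ∀ i j, j ≠ i → A (Pi.single i 1) j = 0 := by
    intro i j hji
    have h := hA (diagonalUnitary (fun l => if l = j then -1 else 1)
      (fun l => by split_ifs <;> simp)) (Pi.single i 1)
    have hfix : Matrix.diagonal (fun l => if l = j then (-1 : ℂ) else 1) *ᵥ
        (Pi.single i 1 : Fin m → ℂ) = Pi.single i 1 := by
      ext l
      rw [Matrix.mulVec_diagonal]
      by_cases hl : l = i
      · subst hl
        simp [hji.symm]
      · simp [hl]
    have h' := congrFun h j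
    simp only [diagonalUnitary, hfix, Matrix.mulVec_diagonal, if_true] at h'
    linear_combination h' / 2
  have hdiag : ∀ i, A (Pi.single i 1) i = A (Pi.single k 1) k := by
    intro i
    have h := congrFun (hA (permUnitary (Equiv.swap i k)) (Pi.single i 1)) k
    have hswap : (Equiv.swap i k).permMatrix ℂ *ᵥ (Pi.single i 1 : Fin m → ℂ)
        = Pi.single k 1 := by
      ext l
      rw [Matrix.permMatrix_mulVec]
      simp [Pi.single_apply, Equiv.swap_apply_eq_iff]
    simp only [permUnitary, hswap, Matrix.permMatrix_mulVec, Function.comp_apply,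
      Equiv.swap_apply_right] at h
    exact h.symm
  have hext : A = A (Pi.single k 1) k • LinearMap.id := by
    refine LinearMap.pi_ext' fun i => LinearMap.ext_ring ?_
    ext j
    by_cases hj : j = i
    · subst hj
      simp [hdiag]
    · simp [hj, hoff i j hj]
  exact LinearMap.congr_fun hext v

/-- The automorphism of `ℂ^n` defined by a unitary matrix acting on the last coordinates. -/
def unitaryAut (n : ℕ) (B : UGrp (n - 1)) : autCn n :=
  ⟨{ toFun := fun p => (p.1, (B : Matrix (Fin (n - 1)) (Fin (n - 1)) ℂ) *ᵥ p.2)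
     invFun := fun p => (p.1, (star B : Matrix (Fin (n - 1)) (Fin (n - 1)) ℂ) *ᵥ p.2)
     left_inv := fun p => by simp [Matrix.mulVec_mulVec]
     right_inv := fun p => by simp [Matrix.mulVec_mulVec] },
   differentiable_fst.prodMk
     (((Matrix.mulVecLin (B : Matrix (Fin (n - 1)) (Fin (n - 1)) ℂ)).toContinuousLinearMap
       ).differentiable.comp differentiable_snd),
   differentiable_fst.prodMk
     (((Matrix.mulVecLin (star B : Matrix (Fin (n - 1)) (Fin (n - 1)) ℂ)).toContinuousLinearMap
       ).differentiable.comp differentiable_snd)⟩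

theorem apply_mulVec_of_mem_centralizer {n : ℕ} {f : autCn n}
    (hf : f ∈ Subgroup.centralizer (unitarySet n)) (B : UGrp (n - 1)) (z : ℂ)
    (v : Fin (n - 1) → ℂ) :
    (f : Equiv.Perm (WSp n)) (z, (B : Matrix (Fin (n - 1)) (Fin (n - 1)) ℂ) *ᵥ v) =
      (((f : Equiv.Perm (WSp n)) (z, v)).1,
        (B : Matrix (Fin (n - 1)) (Fin (n - 1)) ℂ) *ᵥ ((f : Equiv.Perm (WSp n)) (z, v)).2) := by
  have h := Subgroup.mem_centralizer_iff.1 hf (unitaryAut n B) ⟨B, fun _ => rfl⟩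
  have h' := congrArg (fun g : autCn n => (g : Equiv.Perm (WSp n)) (z, v)) h
  exact h'.symm

theorem apply_smul_of_mem_centralizer {n : ℕ} {f : autCn n}
    (hf : f ∈ Subgroup.centralizer (unitarySet n)) {c : ℂ} (hc : ‖c‖ = 1) (z : ℂ)
    (v : Fin (n - 1) → ℂ) :
    (f : Equiv.Perm (WSp n)) (z, c • v) =
      (((f : Equiv.Perm (WSp n)) (z, v)).1, c • ((f : Equiv.Perm (WSp n)) (z, v)).2) := by
  have hdiag : ∀ w : Fin (n - 1) → ℂ, Matrix.diagonal (fun _ => c) *ᵥ w = c • w := fun w => by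
    ext i
    simp [Matrix.mulVec_diagonal]
  have h := apply_mulVec_of_mem_centralizer hf (diagonalUnitary (fun _ => c) fun _ => hc) z v
  simpa only [diagonalUnitary, hdiag] using h

/-- The first component of an element of the centralizer depends only on `z₁`. -/
theorem fst_apply_of_mem_centralizer {n : ℕ} {f : autCn n}
    (hf : f ∈ Subgroup.centralizer (unitarySet n)) (z : ℂ) (v : Fin (n - 1) → ℂ) :
    ((f : Equiv.Perm (WSp n)) (z, v)).1 = ((f : Equiv.Perm (WSp n)) (z, 0)).1 :=
  eq_apply_zero_of_circle_invariant
    (φ := fun v : Fin (n - 1) → ℂ => ((f : Equiv.Perm (WSp n)) (z, v)).1)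
    (differentiable_fst.comp
      (f.2.1.comp ((differentiable_const z).prodMk differentiable_id)))
    (fun _ hc v => by rw [apply_smul_of_mem_centralizer hf hc]) v

/-- The second component of an element of the centralizer is a scalar multiple of `z'`. -/
theorem snd_apply_of_mem_centralizer {n : ℕ} {f : autCn n}
    (hf : f ∈ Subgroup.centralizer (unitarySet n)) (k : Fin (n - 1)) (z : ℂ)
    (v : Fin (n - 1) → ℂ) :
    ((f : Equiv.Perm (WSp n)) (z, v)).2 =
      ((f : Equiv.Perm (WSp n)) (z, Pi.single k 1)).2 k • v := by
  obtain ⟨A, hA⟩ := exists_linear_of_circle_equivariant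
    (φ := fun v : Fin (n - 1) → ℂ => ((f : Equiv.Perm (WSp n)) (z, v)).2)
    (differentiable_snd.comp
      (f.2.1.comp ((differentiable_const z).prodMk differentiable_id)))
    (fun _ hc v => by rw [apply_smul_of_mem_centralizer hf hc])
  have h := eq_smul_of_commute_unitary A.toLinearMap (fun B v => by
    have := congrArg Prod.snd (apply_mulVec_of_mem_centralizer hf B z v)
    simpa only [ContinuousLinearMap.coe_coe, ← hA] using this) k v
  simpa only [ContinuousLinearMap.coe_coe, ← hA] using h

/-- For `n ≥ 2`, the centralizer `C` of `U_{n−1}` in `Aut(ℂ^n)` consists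
exactly of the maps `(z₁, z') ↦ (a z₁ + b, h(z₁) z')` with `a, b ∈ ℂ`, `a ≠ 0`, and `h` a
nowhere-vanishing entire function. -/
theorem centralizer_of_unitary_in_autCn {n : ℕ} (hn : 2 ≤ n) (f : autCn n) :
    f ∈ Subgroup.centralizer (unitarySet n) ↔
      ∃ a b : ℂ, a ≠ 0 ∧ ∃ h : ℂ → ℂ, Differentiable ℂ h ∧ (∀ z, h z ≠ 0) ∧
        ∀ p : WSp n, ((f : Equiv.Perm (WSp n)) p) = (a * p.1 + b, h p.1 • p.2) := by
  constructor
  · intro hf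
    have hfi : f⁻¹ ∈ Subgroup.centralizer (unitarySet n) := inv_mem hf
    have hm : 0 < n - 1 := by omega
    let k : Fin (n - 1) := ⟨0, hm⟩
    have hslice : ∀ (g : autCn n) (v : Fin (n - 1) → ℂ),
        Differentiable ℂ fun z : ℂ => (g : Equiv.Perm (WSp n)) (z, v) := fun g v =>
      g.2.1.comp (differentiable_id.prodMk (differentiable_const v))
    have hinv : ∀ g : autCn n, g ∈ Subgroup.centralizer (unitarySet n) → ∀ z : ℂ,
        ((g : Equiv.Perm (WSp n))
          ((((g⁻¹ : autCn n) : Equiv.Perm (WSp n)) (z, 0)).1, 0)).1 = z := by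
      intro g hg z
      rw [← fst_apply_of_mem_centralizer hg _
        (((g⁻¹ : autCn n) : Equiv.Perm (WSp n)) (z, 0)).2]
      simp
    obtain ⟨a, b, ha, hab⟩ := exists_affine_of_entire_inverse
      (differentiable_fst.comp (hslice f 0)) (differentiable_fst.comp (hslice f⁻¹ 0))
      (hinv f hf) (fun z => by simpa using hinv f⁻¹ hfi z)
    refine ⟨a, b, ha, fun z => ((f : Equiv.Perm (WSp n)) (z, Pi.single k 1)).2 k,
      differentiable_pi.1 (differentiable_snd.comp (hslice f (Pi.single k 1))) k, ?_, ?_⟩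
    · intro z (hz : ((f : Equiv.Perm (WSp n)) (z, Pi.single k 1)).2 k = 0)
      have heq : (f : Equiv.Perm (WSp n)) (z, Pi.single k 1)
          = (f : Equiv.Perm (WSp n)) (z, 0) := by
        refine Prod.ext (fst_apply_of_mem_centralizer hf z _) ?_
        rw [snd_apply_of_mem_centralizer hf k z (Pi.single k 1),
          snd_apply_of_mem_centralizer hf k z 0, hz, zero_smul, zero_smul]
      have := congrFun (congrArg Prod.snd ((f : Equiv.Perm (WSp n)).injective heq)) k
      simp at this
    · rintro ⟨z, v⟩
      exact Prod.ext ((fst_apply_of_mem_centralizer hf z v).trans (hab z))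
        (snd_apply_of_mem_centralizer hf k z v)
  · rintro ⟨a, b, -, h, -, -, hf⟩
    rw [Subgroup.mem_centralizer_iff]
    rintro g ⟨B, hg⟩
    refine Subtype.ext (Equiv.ext fun p => ?_)
    simp only [Subgroup.coe_mul, Equiv.Perm.mul_apply, hf, hg, Matrix.mulVec_smul]

end
end

section
/- Let n ≥ 2, let ℂ^{n*} = ℂ^n∖{0}, and embed U_{n−1} in Aut(ℂ^{n*}) by letting a unitary matrix act on the last n−1 coordinates z' = (z₂,…,z_n) while fixing z₁. Then the centralizer C* of U_{n−1} in Aut(ℂ^{n*}) consists exactly of the maps f = (f₁, f') of the form f₁(z₁,z') = a z₁, f'(z₁,z') = h(z₁) z', where a ∈ ℂ, a ≠ 0, and h is a nowhere-vanishing entire function of one complex variable. -/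
open Matrix
open scoped Manifold

noncomputable section

/-- `ℂ^{n*} = ℂ^n ∖ {0}`, as an open subset of `ℂ^n` — hence a complex manifold. -/
def WStarOpens (n : ℕ) : TopologicalSpace.Opens (WSp n) :=
  ⟨{p | p ≠ 0}, isOpen_ne⟩

/-- The group `Aut(ℂ^{n*})` of biholomorphic automorphisms of `ℂ^{n*} = ℂ^n ∖ {0}`, as a
subgroup of the permutation group. -/
def autCnStar (n : ℕ) : Subgroup (Equiv.Perm (WStarOpens n)) where
  carrier := {f | MDifferentiable 𝓘(ℂ, WSp n) 𝓘(ℂ, WSp n) ⇑f ∧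
                  MDifferentiable 𝓘(ℂ, WSp n) 𝓘(ℂ, WSp n) ⇑f.symm}
  one_mem' := ⟨mdifferentiable_id, mdifferentiable_id⟩
  mul_mem' := by
    rintro f g ⟨hf, hf'⟩ ⟨hg, hg'⟩
    exact ⟨hf.comp hg, hg'.comp hf'⟩
  inv_mem' := by
    rintro f ⟨hf, hf'⟩
    exact ⟨hf', hf⟩

/-- The copy of `U_{n-1}` inside `Aut(ℂ^{n*})`: a unitary matrix `B` acts on the last `n−1`
coordinates `z' = (z₂,…,z_n)` and fixes `z₁`. -/
def unitarySetStar (n : ℕ) : Set (autCnStar n) :=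
  {f | ∃ B : UGrp (n - 1), ∀ p : (WStarOpens n),
    (((f : Equiv.Perm (WStarOpens n)) p : WSp n)) =
      ((p : WSp n).1, (B : Matrix (Fin (n - 1)) (Fin (n - 1)) ℂ) *ᵥ (p : WSp n).2)}

section Entire

open Filter Topology Bornology

variable {E F : Type*} [NormedAddCommGroup E] [NormedSpace ℂ E]
  [NormedAddCommGroup F] [NormedSpace ℂ F]

/-- Two entire functions of one variable agreeing on the unit circle agree on the closed disc. -/
theorem Differentiable.eqOn_closedBall_of_eqOn_circle {u w : ℂ → F} (hu : Differentiable ℂ u)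
    (hw : Differentiable ℂ w) (huw : ∀ c : ℂ, ‖c‖ = 1 → u c = w c) :
    Set.EqOn u w (Metric.closedBall 0 1) := by
  rw [← closure_ball (0 : ℂ) one_ne_zero]
  refine Complex.eqOn_closure_of_eqOn_frontier Metric.isBounded_ball hu.diffContOnCl
    hw.diffContOnCl fun c hc => huw c ?_
  rw [frontier_ball (0 : ℂ) one_ne_zero] at hc
  simpa using hc

theorem Differentiable.apply_eq_apply_zero_of_circle_invariant {φ : E → F}
    (hφ : Differentiable ℂ φ) (h : ∀ c : ℂ, ‖c‖ = 1 → ∀ v, φ (c • v) = φ v) (v : E) :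
    φ v = φ 0 := by
  have key := Differentiable.eqOn_closedBall_of_eqOn_circle (u := fun c : ℂ => φ (c • v))
    (w := fun _ => φ v) (by fun_prop) (by fun_prop) (fun c hc => h c hc v)
  simpa using (key (by simp : (0 : ℂ) ∈ Metric.closedBall 0 1)).symm

theorem Differentiable.eq_fderiv_zero_of_circle_equivariant {φ : E → F}
    (hφ : Differentiable ℂ φ) (h : ∀ c : ℂ, ‖c‖ = 1 → ∀ v, φ (c • v) = c • φ v) (v : E) :
    φ v = fderiv ℂ φ 0 v := by
  have key := Differentiable.eqOn_closedBall_of_eqOn_circle (u := fun c : ℂ => φ (c • v))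
    (w := fun c => c • φ v) (by fun_prop) (by fun_prop) (fun c hc => h c hc v)
  have h₁ : HasDerivAt (fun c : ℂ => φ (c • v)) (fderiv ℂ φ 0 v) 0 := by
    have hs : HasDerivAt (fun c : ℂ => c • v) v 0 := by
      simpa using (hasDerivAt_id (0 : ℂ)).smul_const v
    exact HasFDerivAt.comp_hasDerivAt_of_eq (0 : ℂ) (hφ 0).hasFDerivAt hs (by simp)
  have h₂ : HasDerivAt (fun c : ℂ => c • φ v) (φ v) 0 := by
    simpa using (hasDerivAt_id (0 : ℂ)).smul_const (φ v)
  refine h₂.unique (h₁.congr_of_eventuallyEq ?_)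
  filter_upwards [Metric.closedBall_mem_nhds (0 : ℂ) one_pos] with c hc using (key hc).symm

/-- The germ at infinity of an automorphism of `ℂ` fixing the origin, in the coordinate `1 / z`,
extends holomorphically to the origin. -/
theorem differentiable_inv_comp_inv {g ψ : ℂ → ℂ} (hg : Differentiable ℂ g) (hψ : Continuous ψ)
    (hψg : Function.LeftInverse ψ g) (hgψ : Function.RightInverse ψ g) (hg0 : g 0 = 0) :
    Differentiable ℂ fun ζ => (g ζ⁻¹)⁻¹ := by
  let e : ℂ ≃ₜ ℂ := ⟨⟨g, ψ, hψg, hgψ⟩, hg.continuous, hψ⟩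
  have hcob : Tendsto g (cobounded ℂ) (cobounded ℂ) := by
    rw [Metric.cobounded_eq_cocompact]
    exact e.isClosedEmbedding.tendsto_cocompact
  have hne : ∀ z, z ≠ 0 → g z ≠ 0 := fun z hz h0 => hz (hψg.injective (h0.trans hg0.symm))
  rw [← differentiableOn_univ,
    ← Complex.differentiableOn_compl_singleton_and_continuousAt_iff (c := 0) Filter.univ_mem]
  refine ⟨fun ζ hζ => ?_, ?_⟩
  · have hζ0 : ζ ≠ 0 := by simpa using hζ
    have h₁ : DifferentiableAt ℂ (fun ζ : ℂ => g ζ⁻¹) ζ :=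
      (hg _).comp ζ (differentiableAt_inv hζ0)
    exact (h₁.inv (hne _ (inv_ne_zero hζ0))).differentiableWithinAt
  · rw [continuousAt_iff_punctured_nhds]
    simpa [hg0, Function.comp_def] using
      tendsto_inv₀_cobounded.comp (hcob.comp (tendsto_inv₀_nhdsNE_zero (α := ℂ)))

/-- A holomorphic automorphism of `ℂ` fixing the origin is linear. -/
theorem exists_eq_mul_of_entire_inverse {g ψ : ℂ → ℂ} (hg : Differentiable ℂ g)
    (hψ : Differentiable ℂ ψ) (hψg : Function.LeftInverse ψ g)
    (hgψ : Function.RightInverse ψ g) (hg0 : g 0 = 0) :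
    ∃ a : ℂ, a ≠ 0 ∧ ∀ z, g z = a * z := by
  have hψ0 : ψ 0 = 0 := by simpa [hg0] using hψg 0
  have hw := differentiable_inv_comp_inv hg hψ.continuous hψg hgψ hg0
  have hω := differentiable_inv_comp_inv hψ hg.continuous hgψ hψg hψ0
  set w : ℂ → ℂ := fun ζ => (g ζ⁻¹)⁻¹ with hw_def
  set ω : ℂ → ℂ := fun ζ => (ψ ζ⁻¹)⁻¹ with hω_def
  have hw0 : w 0 = 0 := by simp [hw_def, hg0]
  have hωw : ω ∘ w = id := by
    ext ζ
    simp [hw_def, hω_def, hψg ζ⁻¹]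
  have hd : deriv w 0 ≠ 0 := by
    intro h0
    have h₁ := (hω (w 0)).hasDerivAt.comp (0 : ℂ) (hw 0).hasDerivAt
    rw [hωw, h0, mul_zero] at h₁
    exact one_ne_zero ((hasDerivAt_id (0 : ℂ)).unique h₁)
  have hslope := (hasDerivAt_iff_tendsto_slope.1 (hw 0).hasDerivAt).inv₀ hd
  have hk : Differentiable ℂ (dslope g 0) := by
    rw [← differentiableOn_univ]
    exact (Complex.differentiableOn_dslope Filter.univ_mem).2 hg.differentiableOn
  have hlim : Tendsto (dslope g 0) (cocompact ℂ) (𝓝 (deriv w 0)⁻¹) := by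
    rw [← Metric.cobounded_eq_cocompact]
    refine (hslope.comp (tendsto_inv₀_cobounded' (α := ℂ))).congr' ?_
    filter_upwards [eventually_ne_cobounded (0 : ℂ)] with z hz
    rw [dslope_of_ne _ hz]
    simp [slope_def_field, hw_def, hg0, div_eq_mul_inv, mul_comm]
  refine ⟨(deriv w 0)⁻¹, inv_ne_zero hd, fun z => ?_⟩
  have h₁ := sub_smul_dslope g 0 z
  rw [hk.apply_eq_of_tendsto_cocompact z hlim] at h₁
  simp only [sub_zero, hg0, smul_eq_mul] at h₁
  rw [← h₁, mul_comm]

end Entire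

section Equivariant

variable {ι : Type*} [Fintype ι] [DecidableEq ι]

theorem diagonal_mem_unitaryGroup {d : ι → ℂ} (hd : ∀ i, ‖d i‖ = 1) :
    diagonal d ∈ Matrix.unitaryGroup ι ℂ := by
  rw [Matrix.mem_unitaryGroup_iff, Matrix.star_eq_conjTranspose, diagonal_conjTranspose,
    diagonal_mul_diagonal, ← diagonal_one]
  congr 1
  ext i
  simp [Complex.mul_conj, Complex.normSq_eq_norm_sq, hd]

theorem permMatrix_mem_unitaryGroup (σ : Equiv.Perm ι) :
    σ.permMatrix ℂ ∈ Matrix.unitaryGroup ι ℂ := by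
  rw [Matrix.mem_unitaryGroup_iff, Matrix.star_eq_conjTranspose, conjTranspose_permMatrix,
    ← permMatrix_mul]
  simp

/-- A linear map commuting with every unitary matrix is a homothety. -/
theorem LinearMap.eq_smul_of_unitary_equivariant (L : (ι → ℂ) →ₗ[ℂ] (ι → ℂ))
    (hL : ∀ B ∈ Matrix.unitaryGroup ι ℂ, ∀ v, L (B *ᵥ v) = B *ᵥ L v) (i₀ : ι) (v : ι → ℂ) :
    L v = L (Pi.single i₀ 1) i₀ • v := by
  have hbase : L (Pi.single i₀ 1) = L (Pi.single i₀ 1) i₀ • Pi.single i₀ (1 : ℂ) := by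
    let d : ι → ℂ := fun i => if i = i₀ then 1 else -1
    have h₁ := hL (diagonal d)
      (diagonal_mem_unitaryGroup fun i => by by_cases h : i = i₀ <;> simp [d, h])
      (Pi.single i₀ 1)
    have h₂ : diagonal d *ᵥ Pi.single i₀ 1 = Pi.single i₀ 1 := by
      ext i
      by_cases h : i = i₀
      · subst h; simp [mulVec_diagonal, d]
      · simp [mulVec_diagonal, h]
    rw [h₂] at h₁
    ext i
    by_cases h : i = i₀
    · subst h; simp
    · have h₃ := congrFun h₁ i
      simp only [mulVec_diagonal, d, h, if_false, neg_mul, one_mul] at h₃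
      simpa [h] using self_eq_neg.1 h₃
  have hall : ∀ j, L (Pi.single j 1) = L (Pi.single i₀ 1) i₀ • Pi.single j (1 : ℂ) := by
    intro j
    have h₂ : (Equiv.swap i₀ j).permMatrix ℂ *ᵥ Pi.single i₀ 1 = Pi.single j 1 := by
      ext i
      simp [Pi.single_apply, Equiv.swap_apply_eq_iff]
    have h₁ := hL _ (permMatrix_mem_unitaryGroup (Equiv.swap i₀ j)) (Pi.single i₀ 1)
    rw [h₂, hbase, mulVec_smul, h₂] at h₁
    simpa using h₁
  have hext : L = L (Pi.single i₀ 1) i₀ • LinearMap.id := by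
    refine LinearMap.pi_ext' fun j => LinearMap.ext_ring ?_
    simpa using hall j
  simpa using congrArg (fun M : (ι → ℂ) →ₗ[ℂ] (ι → ℂ) => M v) hext

/-- A holomorphic map on the punctured space `ℂ × ℂ^ι ∖ {0}` commuting with the unitary group
acting on the second factor has the form `(z, v) ↦ (g z, h z • v)`. -/
theorem exists_entire_of_unitary_equivariant [Nonempty ι] {F : ℂ × (ι → ℂ) → ℂ × (ι → ℂ)}
    (hF : ∀ p ≠ 0, DifferentiableAt ℂ F p)
    (hB : ∀ B ∈ Matrix.unitaryGroup ι ℂ, ∀ p ≠ 0,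
      F (p.1, B *ᵥ p.2) = ((F p).1, B *ᵥ (F p).2)) :
    ∃ g h : ℂ → ℂ, Differentiable ℂ g ∧ Differentiable ℂ h ∧
      ∀ p ≠ 0, F p = (g p.1, h p.1 • p.2) := by
  obtain ⟨i₀⟩ := ‹Nonempty ι›
  let e : ι → ℂ := Pi.single i₀ 1
  have he : e ≠ 0 := by simp [e]
  have hline : ∀ v : ι → ℂ, v ≠ 0 → Differentiable ℂ fun z : ℂ => F (z, v) := by
    intro v hv z
    exact (hF (z, v) (by simp [hv])).comp z (by fun_prop)
  have hslice : ∀ z : ℂ, z ≠ 0 → Differentiable ℂ fun v : ι → ℂ => F (z, v) := by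
    intro z hz v
    exact (hF (z, v) (by simp [hz])).comp v (by fun_prop)
  have hg : Differentiable ℂ fun z : ℂ => (F (z, e)).1 := (hline e he).fst
  have hh : Differentiable ℂ fun z : ℂ => (F (z, e)).2 i₀ :=
    differentiable_pi.1 (hline e he).snd i₀
  have hscalar : ∀ c : ℂ, ‖c‖ = 1 → ∀ z : ℂ, z ≠ 0 → ∀ v : ι → ℂ,
      F (z, c • v) = ((F (z, v)).1, c • (F (z, v)).2) := by
    intro c hc z hz v
    have h₁ := hB (diagonal fun _ => c) (diagonal_mem_unitaryGroup fun _ => hc) (z, v)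
      (by simp [hz])
    have h₂ : ∀ u : ι → ℂ, (diagonal fun _ => c) *ᵥ u = c • u := by
      intro u; ext i; simp [mulVec_diagonal]
    simpa [h₂] using h₁
  have hgen : ∀ z : ℂ, z ≠ 0 → ∀ v : ι → ℂ,
      F (z, v) = ((F (z, e)).1, (F (z, e)).2 i₀ • v) := by
    intro z hz v
    have hfst : ∀ u : ι → ℂ, (F (z, u)).1 = (F (z, 0)).1 :=
      (hslice z hz).fst.apply_eq_apply_zero_of_circle_invariant
        fun c hc u => by rw [hscalar c hc z hz u]
    have hsnd : ∀ u : ι → ℂ, (F (z, u)).2 = fderiv ℂ (fun u => (F (z, u)).2) 0 u :=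
      (hslice z hz).snd.eq_fderiv_zero_of_circle_equivariant
        fun c hc u => by rw [hscalar c hc z hz u]
    have hlin := LinearMap.eq_smul_of_unitary_equivariant
      (fderiv ℂ (fun u : ι → ℂ => (F (z, u)).2) 0 : (ι → ℂ) →ₗ[ℂ] (ι → ℂ))
      (fun B hBm u => by
        simp only [ContinuousLinearMap.coe_coe, ← hsnd]
        rw [hB B hBm (z, u) (by simp [hz])]) i₀ v
    simp only [ContinuousLinearMap.coe_coe, ← hsnd] at hlin
    exact Prod.ext ((hfst v).trans (hfst e).symm) hlin
  refine ⟨_, _, hg, hh, ?_⟩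
  rintro ⟨z, v⟩ hp
  by_cases hv : v = 0
  · exact hgen z (by rintro rfl; exact hp (by simp [hv])) v
  · have h₁ : Continuous fun z : ℂ => ((F (z, e)).1, (F (z, e)).2 i₀ • v) :=
      hg.continuous.prodMk (hh.continuous.smul continuous_const)
    exact congrFun (Continuous.ext_on (dense_compl_singleton (0 : ℂ)) (hline v hv).continuous h₁
      fun z hz => hgen z hz v) z

end Equivariant

/-- Biholomorphisms of the punctured space are differentiable in the usual sense, for any
extension to the whole space. -/
theorem differentiableAt_of_autCnStar {n : ℕ} (f : autCnStar n) {F : WSp n → WSp n}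
    (hF : ∀ p : WStarOpens n, F p = ((f : Equiv.Perm (WStarOpens n)) p : WSp n))
    (p : WStarOpens n) : DifferentiableAt ℂ F p := by
  have h₁ : MDifferentiable 𝓘(ℂ, WSp n) 𝓘(ℂ, WSp n) (F ∘ (Subtype.val : WStarOpens n → WSp n)) := by
    have h₂ : F ∘ (Subtype.val : WStarOpens n → WSp n) =
        Subtype.val ∘ ⇑(f : Equiv.Perm (WStarOpens n)) := funext hF
    rw [h₂]
    exact ((contMDiff_subtype_val (n := 1)).mdifferentiable one_ne_zero).comp f.2.1
  exact mdifferentiableAt_iff_differentiableAt.1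
    ((differentiableWithinAt_localInvariantProp.liftPropAt_iff_comp_subtype_val F p).2 (h₁ p))

/-- The automorphism of the punctured space given by a unitary matrix. -/
def unitaryPerm (n : ℕ) (B : UGrp (n - 1)) : Equiv.Perm (WStarOpens n) where
  toFun p := ⟨(p.1.1, (B : Matrix (Fin (n - 1)) (Fin (n - 1)) ℂ) *ᵥ p.1.2), fun h => p.2 <| by
    have h₁ := (Prod.ext_iff.1 h).2
    have h₂ := congrArg (star (B : Matrix (Fin (n - 1)) (Fin (n - 1)) ℂ) *ᵥ ·) h₁
    exact Prod.ext (Prod.ext_iff.1 h).1 (by simpa using h₂)⟩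
  invFun p := ⟨(p.1.1, star (B : Matrix (Fin (n - 1)) (Fin (n - 1)) ℂ) *ᵥ p.1.2), fun h => p.2 <| by
    have h₁ := (Prod.ext_iff.1 h).2
    have h₂ := congrArg ((B : Matrix (Fin (n - 1)) (Fin (n - 1)) ℂ) *ᵥ ·) h₁
    exact Prod.ext (Prod.ext_iff.1 h).1 (by simpa using h₂)⟩
  left_inv p := Subtype.ext (by simp)
  right_inv p := Subtype.ext (by simp)

open scoped ContDiff in
/-- A self-map of the punctured space that is linear in the last coordinates is differentiable. -/
theorem mdifferentiable_of_mulVec {n : ℕ} (M : Matrix (Fin (n - 1)) (Fin (n - 1)) ℂ)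
    {u : WStarOpens n → WStarOpens n}
    (hu : ∀ p, (u p : WSp n) = ((p : WSp n).1, M *ᵥ (p : WSp n).2)) :
    MDifferentiable 𝓘(ℂ, WSp n) 𝓘(ℂ, WSp n) u := by
  refine ContMDiff.mdifferentiable (n := ∞) ?_ (by simp)
  rw [← ContMDiff.subtypeVal_comp_iff]
  let L : WSp n →L[ℂ] WSp n :=
    (ContinuousLinearMap.id ℂ ℂ).prodMap (LinearMap.toContinuousLinearMap M.mulVecLin)
  have h₁ : Subtype.val ∘ u = L ∘ Subtype.val := funext hu
  rw [h₁]
  exact L.contDiff.contMDiff.comp contMDiff_subtype_val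

theorem unitaryPerm_mem (n : ℕ) (B : UGrp (n - 1)) : unitaryPerm n B ∈ autCnStar n :=
  ⟨mdifferentiable_of_mulVec _ fun _ => rfl, mdifferentiable_of_mulVec _ fun _ => rfl⟩

/-- Elements of the centralizer have the form `(z, v) ↦ (g z, h z • v)`. -/
theorem exists_entire_of_mem_centralizer {n : ℕ} (hn : 2 ≤ n) {f : autCnStar n}
    (hf : f ∈ Subgroup.centralizer (unitarySetStar n)) :
    ∃ g h : ℂ → ℂ, Differentiable ℂ g ∧ Differentiable ℂ h ∧
      ∀ p : WStarOpens n, ((f : Equiv.Perm (WStarOpens n)) p : WSp n) =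
        (g (p : WSp n).1, h (p : WSp n).1 • (p : WSp n).2) := by
  classical
  have : Nonempty (Fin (n - 1)) := ⟨⟨0, by omega⟩⟩
  let F : WSp n → WSp n := fun p =>
    if hp : p ≠ 0 then ((f : Equiv.Perm (WStarOpens n)) ⟨p, hp⟩ : WSp n) else 0
  have hF : ∀ p : WStarOpens n, F p = ((f : Equiv.Perm (WStarOpens n)) p : WSp n) :=
    fun p => dif_pos p.2
  obtain ⟨g, h, hg, hh, hgh⟩ := exists_entire_of_unitary_equivariant (F := F)
    (fun p hp => differentiableAt_of_autCnStar f hF ⟨p, hp⟩) (by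
      intro B hB p hp
      let q : WStarOpens n := ⟨p, hp⟩
      have hcomm := Subgroup.mem_centralizer_iff.1 hf
        ⟨unitaryPerm n ⟨B, hB⟩, unitaryPerm_mem n ⟨B, hB⟩⟩ ⟨⟨B, hB⟩, fun _ => rfl⟩
      have h₁ := congrArg
        (fun k : autCnStar n => ((k : Equiv.Perm (WStarOpens n)) q : WSp n)) hcomm
      calc F (p.1, B *ᵥ p.2) = F (unitaryPerm n ⟨B, hB⟩ q) := rfl
        _ = _ := hF _
        _ = _ := h₁.symm
        _ = ((F q).1, B *ᵥ (F q).2) := by rw [hF q]; rfl)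
  exact ⟨g, h, hg, hh, fun p => (hF p).symm.trans (hgh p p.2)⟩

/-- If `(z, v) ↦ (g z, h z • v)` and `(z, v) ↦ (G z, H z • v)` are inverse to each other on the
punctured space, so are `g` and `G`, and `h` has no zeros on the image of `G`. -/
theorem apply_apply_of_fibered_inverse {n : ℕ} (hn : 2 ≤ n) {f f' : Equiv.Perm (WStarOpens n)}
    (hff' : ∀ p, f (f' p) = p) {g h G H : ℂ → ℂ}
    (hf : ∀ p : WStarOpens n, (f p : WSp n) = (g (p : WSp n).1, h (p : WSp n).1 • (p : WSp n).2))
    (hf' : ∀ p : WStarOpens n,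
      (f' p : WSp n) = (G (p : WSp n).1, H (p : WSp n).1 • (p : WSp n).2)) (z : ℂ) :
    g (G z) = z ∧ h (G z) ≠ 0 := by
  let v : Fin (n - 1) → ℂ := fun _ => 1
  let i₀ : Fin (n - 1) := ⟨0, by omega⟩
  have hv : ((z, v) : WSp n) ≠ 0 := fun h0 =>
    one_ne_zero (congrFun (Prod.ext_iff.1 h0).2 i₀ : (1 : ℂ) = 0)
  have h₁ := congrArg Subtype.val (hff' ⟨(z, v), hv⟩)
  rw [hf, hf'] at h₁
  obtain ⟨h₂, h₃⟩ := Prod.ext_iff.1 h₁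
  refine ⟨h₂, fun h0 => ?_⟩
  have h₄ := congrFun h₃ i₀
  simp [h0, v] at h₄

/-- For `n ≥ 2`, the centralizer `C*` of `U_{n−1}` in `Aut(ℂ^{n*})`
consists exactly of the maps `(z₁, z') ↦ (a z₁, h(z₁) z')` with `a ∈ ℂ`, `a ≠ 0`, and `h`
a nowhere-vanishing entire function. -/
theorem centralizer_of_unitary_in_autCnStar {n : ℕ} (hn : 2 ≤ n) (f : autCnStar n) :
    f ∈ Subgroup.centralizer (unitarySetStar n) ↔
      ∃ a : ℂ, a ≠ 0 ∧ ∃ h : ℂ → ℂ, Differentiable ℂ h ∧ (∀ z, h z ≠ 0) ∧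
        ∀ p : (WStarOpens n), (((f : Equiv.Perm (WStarOpens n)) p : WSp n)) =
          (a * (p : WSp n).1, h (p : WSp n).1 • (p : WSp n).2) := by
  constructor
  · intro hf
    obtain ⟨g, h, hg, hh, hgh⟩ := exists_entire_of_mem_centralizer hn hf
    obtain ⟨G, H, hG, hH, hGH⟩ := exists_entire_of_mem_centralizer hn (inv_mem hf)
    have hleft : ∀ p, (f : Equiv.Perm (WStarOpens n))
        (((f⁻¹ : autCnStar n) : Equiv.Perm (WStarOpens n)) p) = p :=
      fun p => Equiv.apply_symm_apply _ p
    have hright : ∀ p, ((f⁻¹ : autCnStar n) : Equiv.Perm (WStarOpens n))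
        ((f : Equiv.Perm (WStarOpens n)) p) = p :=
      fun p => Equiv.symm_apply_apply _ p
    have hgG := apply_apply_of_fibered_inverse hn hleft hgh hGH
    have hGg := apply_apply_of_fibered_inverse hn hright hGH hgh
    have hg0 : g 0 = 0 := by
      by_contra hb
      let q : WStarOpens n := ⟨(g 0, 0), fun h0 => hb (Prod.ext_iff.1 h0).1⟩
      refine (((f⁻¹ : autCnStar n) : Equiv.Perm (WStarOpens n)) q).2 ?_
      rw [hGH q]
      exact Prod.ext (hGg 0).1 (smul_zero _)
    obtain ⟨a, ha, hga⟩ := exists_eq_mul_of_entire_inverse hg hG (fun z => (hGg z).1)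
      (fun z => (hgG z).1) hg0
    refine ⟨a, ha, h, hh, fun z => ?_, fun p => by rw [hgh p, hga]⟩
    simpa [(hGg z).1] using (hgG (g z)).2
  · rintro ⟨a, -, h, -, -, hf⟩
    rw [Subgroup.mem_centralizer_iff]
    rintro k ⟨B, hk⟩
    refine Subtype.ext (Equiv.ext fun p => Subtype.ext ?_)
    change (((k : Equiv.Perm (WStarOpens n)) ((f : Equiv.Perm (WStarOpens n)) p) : WSp n)) =
      (f : Equiv.Perm (WStarOpens n)) ((k : Equiv.Perm (WStarOpens n)) p)
    rw [hk, hf, hf, hk, mulVec_smul]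

end
end

section
/- Let n ≥ 2 and let C* be the centralizer of U_{n−1} in Aut(ℂ^{n*}), i.e., the group of all maps (z₁,z') ↦ (a z₁, h(z₁) z') with a ∈ ℂ∖{0} and h a nowhere-vanishing entire function. Then the commutator subgroup of C* consists exactly of the maps (z₁,z') ↦ (z₁, h(z₁) z') with h a nowhere-vanishing entire function satisfying h(0) = 1; in particular, the commutator subgroup of C* is abelian. -/
open Matrix
open scoped Manifold

noncomputable section

open Filter Topology Bornology
open scoped commutatorElement

theorem mdifferentiable_iff_val_comp {n : ℕ} {f : WStarOpens n → WStarOpens n} :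
    MDifferentiable 𝓘(ℂ, WSp n) 𝓘(ℂ, WSp n) f ↔
      MDifferentiable 𝓘(ℂ, WSp n) 𝓘(ℂ, WSp n) (fun p => (f p : WSp n)) := by
  refine forall_congr' fun x => ?_
  rw [mdifferentiableAt_iff, mdifferentiableAt_iff]
  refine and_congr ?_ ?_
  · exact Topology.IsEmbedding.subtypeVal.continuousAt_iff
  · rfl

theorem mdifferentiableAt_comp_val {n : ℕ} {F : WSp n → WSp n} {x : WStarOpens n} :
    MDifferentiableAt 𝓘(ℂ, WSp n) 𝓘(ℂ, WSp n) (fun p : WStarOpens n => F p) x ↔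
      DifferentiableAt ℂ F x := by
  rw [← mdifferentiableAt_iff_differentiableAt]
  exact (differentiableWithinAt_localInvariantProp.liftPropAt_iff_comp_subtype_val F x).symm

theorem Differentiable.eq_const_of_eq_on_unit_circle {E : Type*} [NormedAddCommGroup E]
    [NormedSpace ℂ E] [CompleteSpace E] {g : ℂ → E} (hg : Differentiable ℂ g) {c : E}
    (h : ∀ z : ℂ, ‖z‖ = 1 → g z = c) (z : ℂ) : g z = c := by
  have hball : Set.EqOn g (fun _ => c) (Metric.ball 0 1) := by
    refine Complex.eqOn_of_eqOn_frontier Metric.isBounded_ball hg.diffContOnCl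
      diffContOnCl_const fun w hw => h w ?_
    rw [frontier_ball _ one_ne_zero] at hw
    simpa using hw
  have := AnalyticOnNhd.eq_of_eventuallyEq (z₀ := 0)
    (fun w _ => hg.analyticAt w : AnalyticOnNhd ℂ g Set.univ) analyticOnNhd_const
    (hball.eventuallyEq_of_mem (Metric.ball_mem_nhds 0 one_pos))
  exact congrFun this z

theorem Homeomorph.differentiable_conj_inv (φ : ℂ ≃ₜ ℂ) (hφ : Differentiable ℂ φ)
    (h0 : φ 0 = 0) : Differentiable ℂ fun w => (φ w⁻¹)⁻¹ := by
  have hne : ∀ z ≠ 0, φ z ≠ 0 := fun z hz h => hz (φ.injective (h.trans h0.symm))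
  rw [← differentiableOn_univ,
    ← Complex.differentiableOn_compl_singleton_and_continuousAt_iff (c := 0) univ_mem]
  constructor
  · intro w hw
    have hw : w ≠ 0 := by simpa using hw
    exact (((hφ _).comp w (differentiableAt_inv hw)).inv
      (hne _ (inv_ne_zero hw))).differentiableWithinAt
  · rw [continuousAt_iff_punctured_nhds]
    have h1 : Tendsto φ (cobounded ℂ) (cobounded ℂ) := by
      simpa only [Metric.cobounded_eq_cocompact] using
        φ.isClosedEmbedding.tendsto_cocompact
    simpa [h0, Function.comp_def] using tendsto_inv₀_cobounded.comp (h1.comp tendsto_inv₀_nhdsNE_zero)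

/-- Biholomorphic self-maps of `ℂ` fixing the origin are linear. -/
theorem Complex.exists_eq_mul_of_leftInverse {φ ψ : ℂ → ℂ} (hφ : Differentiable ℂ φ)
    (hψ : Differentiable ℂ ψ) (hl : Function.LeftInverse ψ φ) (hr : Function.RightInverse ψ φ)
    (h0 : φ 0 = 0) : ∃ a : ℂ, a ≠ 0 ∧ ∀ z, φ z = a * z := by
  let e : ℂ ≃ₜ ℂ := ⟨⟨φ, ψ, hl, hr⟩, hφ.continuous, hψ.continuous⟩
  have hψ0 : ψ 0 = 0 := by simpa [h0] using hl 0
  let k : ℂ → ℂ := fun w => (φ w⁻¹)⁻¹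
  let l : ℂ → ℂ := fun w => (ψ w⁻¹)⁻¹
  have hk : Differentiable ℂ k := e.differentiable_conj_inv hφ h0
  have hl' : Differentiable ℂ l := e.symm.differentiable_conj_inv hψ hψ0
  have hlk : l ∘ k = id := by
    funext w
    simp [l, k, hl w⁻¹]
  have hc : deriv k 0 ≠ 0 := by
    intro hc
    have h1 := (hl' (k 0)).hasDerivAt.comp 0 (hk 0).hasDerivAt
    rw [hlk, hc, mul_zero] at h1
    exact one_ne_zero ((hasDerivAt_id (0 : ℂ)).unique h1)
  have hd : Differentiable ℂ (dslope φ 0) := by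
    rw [← differentiableOn_univ, Complex.differentiableOn_dslope univ_mem]
    exact hφ.differentiableOn
  have hlim : Tendsto (dslope φ 0) (cocompact ℂ) (𝓝 (deriv k 0)⁻¹) := by
    have h1 := (hasDerivAt_iff_tendsto_slope.1 (hk 0).hasDerivAt).comp
      (tendsto_inv₀_cobounded' (α := ℂ))
    rw [← Metric.cobounded_eq_cocompact]
    refine (h1.inv₀ hc).congr' ?_
    filter_upwards [eventually_ne_cobounded (0 : ℂ)] with z hz
    rw [dslope_of_ne _ hz]
    simp [slope_def_field, h0, k, div_eq_mul_inv, mul_comm]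
  refine ⟨(deriv k 0)⁻¹, inv_ne_zero hc, fun z => ?_⟩
  have h1 := sub_smul_dslope φ 0 z
  rw [hd.apply_eq_of_tendsto_cocompact z hlim, h0] at h1
  simpa [mul_comm] using h1.symm

/-- The multiplicative cohomological equation `k (2 z) = h z * k z` has a zero-free entire
solution. -/
theorem Complex.exists_comp_two_mul_eq_mul {h : ℂ → ℂ} (hd : Differentiable ℂ h)
    (hne : ∀ z, h z ≠ 0) (h0 : h 0 = 1) :
    ∃ k : ℂ → ℂ, Differentiable ℂ k ∧ (∀ z, k z ≠ 0) ∧ ∀ z, k (2 * z) = h z * k z := by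
  let f : ℕ → ℂ → ℂ := fun j z => h (z / 2 ^ (j + 1)) - 1
  have hfd : ∀ j, Differentiable ℂ (f j) := fun j =>
    (hd.comp (differentiable_id.div_const _)).sub_const 1
  have hbound : ∀ R : ℝ, ∃ C : ℝ, ∀ j, ∀ z ∈ Metric.closedBall (0 : ℂ) R,
      ‖f j z‖ ≤ C * (1 / 2) ^ j := by
    intro R
    have hds : Differentiable ℂ (dslope h 0) := by
      rw [← differentiableOn_univ, Complex.differentiableOn_dslope univ_mem]
      exact hd.differentiableOn
    obtain ⟨M, hM⟩ := (isCompact_closedBall (0 : ℂ) R).exists_bound_of_continuousOn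
      hds.continuous.continuousOn
    refine ⟨R * M, fun j z hz => ?_⟩
    have hzR : ‖z‖ ≤ R := by simpa using hz
    have hR : 0 ≤ R := (norm_nonneg z).trans hzR
    have hpow : ‖z / 2 ^ (j + 1)‖ ≤ R * (1 / 2) ^ j := by
      rw [norm_div, norm_pow, Complex.norm_ofNat, div_eq_mul_inv, one_div, inv_pow]
      gcongr
      · norm_num
      · omega
    have hmem : ‖z / 2 ^ (j + 1)‖ ≤ R :=
      hpow.trans (mul_le_of_le_one_right hR (pow_le_one₀ (by norm_num) (by norm_num)))
    have h1 := sub_smul_dslope h 0 (z / 2 ^ (j + 1))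
    have h2 : f j z = (z / 2 ^ (j + 1)) • dslope h 0 (z / 2 ^ (j + 1)) := by
      simpa [f, h0] using h1.symm
    have hM' := hM (z / 2 ^ (j + 1)) (by simpa using hmem)
    rw [h2, norm_smul]
    calc _ ≤ (R * (1 / 2) ^ j) * M := by gcongr
      _ = _ := by ring
  have hgeom : ∀ C : ℝ, Summable fun j : ℕ => C * (1 / 2 : ℝ) ^ j := fun C =>
    summable_geometric_two.mul_left C
  have hsum : ∀ z, Summable fun j => ‖f j z‖ := fun z => by
    obtain ⟨C, hC⟩ := hbound ‖z‖
    exact (hgeom C).of_nonneg_of_le (fun _ => norm_nonneg _) fun j => hC j z (by simp)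
  have hprod : HasProdLocallyUniformlyOn (fun j z => 1 + f j z)
      (fun z => ∏' j, (1 + f j z)) Set.univ := by
    refine hasProdLocallyUniformlyOn_of_forall_compact isOpen_univ fun K _ hK => ?_
    obtain ⟨R, hR⟩ := hK.isBounded.subset_closedBall (0 : ℂ)
    obtain ⟨C, hC⟩ := hbound R
    exact (hgeom C).hasProdUniformlyOn_nat_one_add hK
      (.of_forall fun j z hz => hC j z (hR hz)) fun j => (hfd j).continuous.continuousOn
  refine ⟨fun z => ∏' j, (1 + f j z), ?_, fun z => ?_, fun z => ?_⟩
  · rw [← differentiableOn_univ]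
    refine hprod.differentiableOn (.of_forall fun s => ?_) isOpen_univ
    simpa [Finset.prod_fn] using
      DifferentiableOn.finsetProd fun j _ => ((hfd j).const_add 1).differentiableOn
  · exact tprod_one_add_ne_zero_of_summable (fun j => by simpa [f] using hne _) (hsum z)
  · have hshift : ∀ j, 1 + f (j + 1) (2 * z) = 1 + f j z := fun j => by
      have : 2 * z / 2 ^ (j + 1 + 1) = z / 2 ^ (j + 1) := by
        rw [pow_succ _ (j + 1)]
        field_simp
      simp only [f, this]
    have hzero : 1 + f 0 (2 * z) = h z := by simp [f]
    change ∏' j, (1 + f j (2 * z)) = h z * ∏' j, (1 + f j z)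
    rw [tprod_eq_zero_mul' (by simpa only [hshift] using multipliable_one_add_of_summable (hsum z)),
      hzero]
    simp only [hshift]

/-- Entire in the first variable and linear in the remaining ones: the shape of maps on
`(ℂ × ℂ^ι) ∖ {0}` that are equivariant under the unitary group of the second factor. -/
theorem exists_eq_prod_smul_of_unitary_equivariant {ι : Type*} [Fintype ι] [DecidableEq ι]
    [Nonempty ι] {F : ℂ × (ι → ℂ) → ℂ × (ι → ℂ)} (hd : ∀ p ≠ 0, DifferentiableAt ℂ F p)
    (hF : ∀ B : Matrix.unitaryGroup ι ℂ, ∀ p ≠ 0,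
      F (p.1, (B : Matrix ι ι ℂ) *ᵥ p.2) = ((F p).1, (B : Matrix ι ι ℂ) *ᵥ (F p).2)) :
    ∃ φ h : ℂ → ℂ, Differentiable ℂ φ ∧ Differentiable ℂ h ∧
      ∀ p ≠ 0, F p = (φ p.1, h p.1 • p.2) := by
  have ne₁ : ∀ {z : ℂ} (v : ι → ℂ), z ≠ 0 → (z, v) ≠ 0 := fun v hz h =>
    hz (congrArg Prod.fst h)
  have ne₂ : ∀ (z : ℂ) {v : ι → ℂ}, v ≠ 0 → (z, v) ≠ 0 := fun z v hv h =>
    hv (congrArg Prod.snd h)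
  have circ : ∀ {z : ℂ} (v : ι → ℂ), z ≠ 0 → ∀ c : ℂ, ‖c‖ = 1 →
      F (z, c • v) = ((F (z, v)).1, c • (F (z, v)).2) := by
    intro z v hz c hc
    have hB : (c • (1 : Matrix ι ι ℂ)) ∈ Matrix.unitaryGroup ι ℂ := by
      rw [Matrix.mem_unitaryGroup_iff, star_smul, star_one, smul_mul_smul_comm, mul_one]
      simp [Complex.mul_conj', hc]
    simpa [Matrix.smul_mulVec] using hF ⟨_, hB⟩ (z, v) (ne₁ v hz)
  have line : ∀ {z : ℂ} (v : ι → ℂ), z ≠ 0 → Differentiable ℂ fun w : ℂ => F (z, w • v) :=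
    fun {z} v hz w => (hd _ (ne₁ _ hz)).comp w (by fun_prop)
  have fst_smul : ∀ {z : ℂ} (v : ι → ℂ), z ≠ 0 → ∀ w : ℂ,
      (F (z, w • v)).1 = (F (z, v)).1 := fun {z} v hz w =>
    (line v hz).fst.eq_const_of_eq_on_unit_circle (fun c hc => by rw [circ v hz c hc]) w
  have snd_smul : ∀ {z : ℂ} (v : ι → ℂ), z ≠ 0 → ∀ w : ℂ,
      (F (z, w • v)).2 = w • (F (z, v)).2 := fun {z} v hz w => by
    have h1 : Differentiable ℂ fun w : ℂ => (F (z, w • v)).2 - w • (F (z, v)).2 :=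
      (line v hz).snd.sub (by fun_prop)
    exact sub_eq_zero.1 (h1.eq_const_of_eq_on_unit_circle
      (fun c hc => by rw [circ v hz c hc, sub_self]) w)
  let i₀ : ι := Classical.arbitrary ι
  let e : ι → ℂ := Pi.single i₀ 1
  have he : e ≠ 0 := fun h => one_ne_zero (α := ℂ) (by simpa [e] using congrFun h i₀)
  have slice : ∀ {v : ι → ℂ}, v ≠ 0 → Differentiable ℂ fun z : ℂ => F (z, v) :=
    fun {v} hv z => (hd _ (ne₂ z hv)).comp z (by fun_prop)
  let φ : ℂ → ℂ := fun z => (F (z, e)).1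
  let h : ℂ → ℂ := fun z => (F (z, e)).2 i₀
  have hφ : Differentiable ℂ φ := (slice he).fst
  have hh : Differentiable ℂ h := differentiable_pi.1 (slice he).snd i₀
  have off : ∀ {z : ℂ} (v : ι → ℂ), z ≠ 0 → F (z, v) = (φ z, h z • v) := by
    intro z v hz
    refine Prod.ext ?_ ?_
    · have h1 := fst_smul v hz 0
      have h2 := fst_smul e hz 0
      rw [zero_smul] at h1 h2
      exact h1.symm.trans h2
    · let G : (ι → ℂ) → (ι → ℂ) := fun v => (F (z, v)).2
      have hG : DifferentiableAt ℂ G 0 :=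
        ((hd (z, 0) (ne₁ 0 hz)).comp (0 : ι → ℂ) (by fun_prop)).snd
      let L := fderiv ℂ G 0
      have hL : ∀ v, G v = L v := by
        intro v
        have h1 : HasDerivAt (fun w : ℂ => w • v) v 0 := by
          simpa using (hasDerivAt_id (0 : ℂ)).smul_const v
        have h2 : HasDerivAt (fun w : ℂ => G (w • v)) (L v) 0 := by
          refine HasFDerivAt.comp_hasDerivAt (0 : ℂ) (l := G) ?_ h1
          simpa using hG.hasFDerivAt
        have h3 : HasDerivAt (fun w : ℂ => G (w • v)) (G v) 0 := by
          simp only [G, snd_smul v hz]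
          simpa using (hasDerivAt_id (0 : ℂ)).smul_const (G v)
        exact h3.unique h2
      have hGB : ∀ (B : Matrix.unitaryGroup ι ℂ) v,
          G ((B : Matrix ι ι ℂ) *ᵥ v) = (B : Matrix ι ι ℂ) *ᵥ G v := fun B v =>
        congrArg Prod.snd (hF B (z, v) (ne₁ v hz))
      have hGe : G e = h z • e := by
        funext k
        rcases eq_or_ne k i₀ with rfl | hk
        · simp [G, h, e]
        · let d : ι → ℂ := Function.update 1 k (-1)
          have hB : Matrix.diagonal d ∈ Matrix.unitaryGroup ι ℂ := by
            rw [Matrix.mem_unitaryGroup_iff, Matrix.star_eq_conjTranspose,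
              Matrix.diagonal_conjTranspose, Matrix.diagonal_mul_diagonal, ← Matrix.diagonal_one]
            congr 1
            funext i
            rcases eq_or_ne i k with rfl | hi <;> simp [d, *]
          have h1 := congrFun (hGB ⟨_, hB⟩ e) k
          have h2 : Matrix.diagonal d *ᵥ e = e := by
            funext i
            rcases eq_or_ne i i₀ with rfl | hi <;> simp [Matrix.mulVec_diagonal, d, e, *, hk.symm]
          simp only [h2, Matrix.mulVec_diagonal] at h1
          have h3 : G e k = 0 := by
            simp only [d, Function.update_self] at h1
            linear_combination h1 / 2
          simp [h3, e, hk]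
      have hGj : ∀ j, G (Pi.single j 1) = h z • Pi.single j 1 := by
        intro j
        have hB : (Equiv.swap i₀ j).permMatrix ℂ ∈ Matrix.unitaryGroup ι ℂ := by
          rw [Matrix.mem_unitaryGroup_iff, Matrix.star_eq_conjTranspose,
            Matrix.conjTranspose_permMatrix, ← Matrix.permMatrix_mul]
          simp
        have h2 : (Equiv.swap i₀ j).permMatrix ℂ *ᵥ e = Pi.single j 1 := by
          rw [Matrix.permMatrix_mulVec]
          funext i
          simp only [e, Function.comp, Pi.single_apply]
          exact if_congr (by rw [Equiv.swap_apply_eq_iff, Equiv.swap_apply_left]) rfl rfl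
        have h1 := hGB ⟨_, hB⟩ e
        simp only [h2, hGe, Matrix.mulVec_smul] at h1
        exact h1
      change G v = h z • v
      conv_lhs => rw [hL, pi_eq_sum_univ' v, map_sum]
      conv_rhs => rw [pi_eq_sum_univ' v, Finset.smul_sum]
      refine Finset.sum_congr rfl fun j _ => ?_
      rw [map_smul, ← hL]
      simp only [hGj]
      exact smul_comm _ _ _
  refine ⟨φ, h, hφ, hh, ?_⟩
  rintro ⟨z, v⟩ hp
  rcases eq_or_ne z 0 with rfl | hz
  · have hv : v ≠ 0 := fun hv => hp (by rw [hv]; rfl)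
    have h1 : Tendsto (fun z => F (z, v)) (𝓝[≠] 0) (𝓝 (F (0, v))) :=
      ((slice hv).continuous.tendsto 0).mono_left nhdsWithin_le_nhds
    have h2 : Tendsto (fun z => (φ z, h z • v)) (𝓝[≠] 0) (𝓝 (φ 0, h 0 • v)) :=
      ((hφ.continuous.prodMk (hh.continuous.smul continuous_const)).tendsto 0).mono_left
        nhdsWithin_le_nhds
    exact tendsto_nhds_unique_of_eventuallyEq h1 h2
      (eventually_nhdsWithin_of_forall fun z hz => off v hz)
  · exact off v hz

/-- The automorphism of `ℂ^{n*}` induced by a biholomorphic map of `ℂ^n` fixing the origin. -/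
def autOfBiholomorphic {n : ℕ} (e : WSp n ≃ WSp n) (he : Differentiable ℂ e)
    (he' : Differentiable ℂ e.symm) (h0 : e 0 = 0) : autCnStar n :=
  ⟨e.subtypeEquiv fun _ => (e.injective.ne_iff' h0).symm,
    mdifferentiable_iff_val_comp.2 fun x => mdifferentiableAt_comp_val.2 (he x),
    mdifferentiable_iff_val_comp.2 fun x => mdifferentiableAt_comp_val.2 (he' x)⟩

theorem autCnStar_ext {n : ℕ} {f g : autCnStar n}
    (h : ∀ p : WStarOpens n, ((f : Equiv.Perm (WStarOpens n)) p : WSp n) =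
      (g : Equiv.Perm (WStarOpens n)) p) : f = g :=
  Subtype.ext (Equiv.ext fun p => Subtype.ext (h p))

theorem exists_autCnStar_unitary {n : ℕ} (B : UGrp (n - 1)) :
    ∃ f : autCnStar n, ∀ p : WStarOpens n, ((f : Equiv.Perm (WStarOpens n)) p : WSp n) =
      ((p : WSp n).1, (B : Matrix (Fin (n - 1)) (Fin (n - 1)) ℂ) *ᵥ (p : WSp n).2) := by
  have hd : ∀ C : Matrix (Fin (n - 1)) (Fin (n - 1)) ℂ,
      Differentiable ℂ fun p : WSp n => (p.1, C *ᵥ p.2) := fun C =>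
    differentiable_fst.prodMk
      ((LinearMap.toContinuousLinearMap C.mulVecLin).differentiable.comp differentiable_snd)
  refine ⟨autOfBiholomorphic
    ⟨fun p => (p.1, (B : Matrix (Fin (n - 1)) (Fin (n - 1)) ℂ) *ᵥ p.2),
      fun p => (p.1, star (B : Matrix (Fin (n - 1)) (Fin (n - 1)) ℂ) *ᵥ p.2),
      fun p => ?_, fun p => ?_⟩ (hd _) (hd _) ?_, fun p => rfl⟩
  · simp
  · simp
  · change ((0 : ℂ), (B : Matrix (Fin (n - 1)) (Fin (n - 1)) ℂ) *ᵥ 0) = 0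
    rw [Matrix.mulVec_zero]
    rfl

theorem exists_autCnStar_scaling (n : ℕ) {a : ℂ} (ha : a ≠ 0) {h : ℂ → ℂ}
    (hd : Differentiable ℂ h) (hne : ∀ z, h z ≠ 0) :
    ∃ f : autCnStar n, ∀ p : WStarOpens n, ((f : Equiv.Perm (WStarOpens n)) p : WSp n) =
      (a * (p : WSp n).1, h (p : WSp n).1 • (p : WSp n).2) := by
  refine ⟨autOfBiholomorphic
    ⟨fun p => (a * p.1, h p.1 • p.2), fun p => (a⁻¹ * p.1, (h (a⁻¹ * p.1))⁻¹ • p.2),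
      fun p => ?_, fun p => ?_⟩ ?_ ?_ ?_, fun p => rfl⟩
  · simp [ha, smul_smul, hne]
  · simp [ha, smul_smul, hne]
  · change Differentiable ℂ fun p : WSp n => (a * p.1, h p.1 • p.2)
    fun_prop
  · change Differentiable ℂ fun p : WSp n => (a⁻¹ * p.1, (h (a⁻¹ * p.1))⁻¹ • p.2)
    have : Differentiable ℂ fun p : WSp n => (h (a⁻¹ * p.1))⁻¹ :=
      Differentiable.inv (by fun_prop) fun p => hne _
    fun_prop
  · change (a * (0 : ℂ), h 0 • (0 : Fin (n - 1) → ℂ)) = 0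
    rw [mul_zero, smul_zero]
    rfl

theorem mem_centralizer_unitarySetStar_of_scaling {n : ℕ} {f : autCnStar n} {a : ℂ} {h : ℂ → ℂ}
    (hf : ∀ p : WStarOpens n, ((f : Equiv.Perm (WStarOpens n)) p : WSp n) =
      (a * (p : WSp n).1, h (p : WSp n).1 • (p : WSp n).2)) :
    f ∈ Subgroup.centralizer (unitarySetStar n) := by
  rintro g ⟨B, hB⟩
  refine autCnStar_ext fun p => ?_
  change (((g : Equiv.Perm (WStarOpens n)) ((f : Equiv.Perm (WStarOpens n)) p)) : WSp n) =
    ((f : Equiv.Perm (WStarOpens n)) ((g : Equiv.Perm (WStarOpens n)) p) : WSp n)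
  rw [hB, hf, hf, hB]
  simp [Matrix.mulVec_smul]

theorem exists_eq_prod_smul_of_mem_centralizer {n : ℕ} (hn : 2 ≤ n) {f : autCnStar n}
    (hf : f ∈ Subgroup.centralizer (unitarySetStar n)) :
    ∃ φ h : ℂ → ℂ, Differentiable ℂ φ ∧ Differentiable ℂ h ∧
      ∀ p : WStarOpens n, ((f : Equiv.Perm (WStarOpens n)) p : WSp n) =
        (φ (p : WSp n).1, h (p : WSp n).1 • (p : WSp n).2) := by
  classical
  have : Nonempty (Fin (n - 1)) := ⟨⟨0, by omega⟩⟩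
  let F : WSp n → WSp n := fun p =>
    if hp : p ≠ 0 then ((f : Equiv.Perm (WStarOpens n)) ⟨p, hp⟩ : WSp n) else 0
  have hF : ∀ p : WStarOpens n, F p = (f : Equiv.Perm (WStarOpens n)) p := fun p =>
    dif_pos p.2
  have hFd : ∀ p ≠ 0, DifferentiableAt ℂ F p := fun p hp => by
    refine (mdifferentiableAt_comp_val (x := ⟨p, hp⟩)).1 ?_
    simp only [hF]
    exact mdifferentiable_iff_val_comp.1 f.2.1 _
  have hFB : ∀ B : UGrp (n - 1), ∀ p ≠ 0,
      F (p.1, (B : Matrix (Fin (n - 1)) (Fin (n - 1)) ℂ) *ᵥ p.2) =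
        ((F p).1, (B : Matrix (Fin (n - 1)) (Fin (n - 1)) ℂ) *ᵥ (F p).2) := by
    intro B p hp
    obtain ⟨g, hg⟩ := exists_autCnStar_unitary B
    have h1 : ((g * f : autCnStar n) : Equiv.Perm (WStarOpens n)) ⟨p, hp⟩ =
        ((f * g : autCnStar n) : Equiv.Perm (WStarOpens n)) ⟨p, hp⟩ := by rw [hf g ⟨B, hg⟩]
    have h2 := congrArg Subtype.val h1
    change ((g : Equiv.Perm (WStarOpens n)) ((f : Equiv.Perm (WStarOpens n)) ⟨p, hp⟩) : WSp n) =
      ((f : Equiv.Perm (WStarOpens n)) ((g : Equiv.Perm (WStarOpens n)) ⟨p, hp⟩) : WSp n) at h2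
    rw [hg, ← hF, ← hF, hg] at h2
    exact h2.symm
  obtain ⟨φ, h, hφ, hh, H⟩ := exists_eq_prod_smul_of_unitary_equivariant hFd hFB
  exact ⟨φ, h, hφ, hh, fun p => (hF p).symm.trans (H p p.2)⟩

/-- Elements of the centralizer of `U_{n-1}` have the form `(z₁, z') ↦ (a z₁, h(z₁) z')`. -/
theorem exists_scaling_of_mem_centralizer {n : ℕ} (hn : 2 ≤ n) {f : autCnStar n}
    (hf : f ∈ Subgroup.centralizer (unitarySetStar n)) :
    ∃ (a : ℂ) (h : ℂ → ℂ), a ≠ 0 ∧ Differentiable ℂ h ∧ (∀ z, h z ≠ 0) ∧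
      ∀ p : WStarOpens n, ((f : Equiv.Perm (WStarOpens n)) p : WSp n) =
        (a * (p : WSp n).1, h (p : WSp n).1 • (p : WSp n).2) := by
  have : Nonempty (Fin (n - 1)) := ⟨⟨0, by omega⟩⟩
  obtain ⟨φ, h, hφ, hh, H⟩ := exists_eq_prod_smul_of_mem_centralizer hn hf
  obtain ⟨ψ, l, hψ, -, K⟩ := exists_eq_prod_smul_of_mem_centralizer hn (inv_mem hf)
  have hfi : ∀ p, ((f⁻¹ : autCnStar n) : Equiv.Perm (WStarOpens n))
      ((f : Equiv.Perm (WStarOpens n)) p) = p := Equiv.symm_apply_apply _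
  have hif : ∀ p, (f : Equiv.Perm (WStarOpens n))
      (((f⁻¹ : autCnStar n) : Equiv.Perm (WStarOpens n)) p) = p := Equiv.apply_symm_apply _
  have hstar : ∀ z : ℂ, ((z, 1) : WSp n) ≠ 0 := fun z hz =>
    one_ne_zero (congrArg Prod.snd hz)
  have hl : ∀ z, (ψ (φ z), l (φ z) • h z • (1 : Fin (n - 1) → ℂ)) = (z, 1) := fun z => by
    have h1 := congrArg Subtype.val (hfi ⟨(z, 1), hstar z⟩)
    rwa [K, H] at h1
  have hr : Function.RightInverse ψ φ := fun z => by
    have h1 := congrArg Subtype.val (hif ⟨(z, 1), hstar z⟩)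
    rw [H, K] at h1
    exact congrArg Prod.fst h1
  have hψ0 : ψ 0 = 0 := by
    by_contra hne
    let q : WStarOpens n := ⟨(ψ 0, 0), fun hq => hne (congrArg Prod.fst hq)⟩
    refine ((f : Equiv.Perm (WStarOpens n)) q).2 ?_
    rw [H q]
    simp [q, hr 0]
  obtain ⟨a, ha, hφa⟩ := Complex.exists_eq_mul_of_leftInverse hφ hψ
    (fun z => congrArg Prod.fst (hl z)) hr (by simpa [hψ0] using hr 0)
  refine ⟨a, h, ha, hh, fun z hz => ?_, fun p => by rw [H, hφa]⟩
  have h1 := congrArg Prod.snd (hl z)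
  simp only [hz, zero_smul, smul_zero] at h1
  exact zero_ne_one h1

theorem exists_scaling_of_mem_commutator {n : ℕ} (hn : 2 ≤ n) {f : autCnStar n}
    (hf : f ∈ ⁅Subgroup.centralizer (unitarySetStar n),
      Subgroup.centralizer (unitarySetStar n)⁆) :
    ∃ h : ℂ → ℂ, Differentiable ℂ h ∧ (∀ z, h z ≠ 0) ∧ h 0 = 1 ∧
      ∀ p : WStarOpens n, ((f : Equiv.Perm (WStarOpens n)) p : WSp n) =
        ((p : WSp n).1, h (p : WSp n).1 • (p : WSp n).2) := by
  rw [Subgroup.commutator_def] at hf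
  induction hf using Subgroup.closure_induction with
  | mem x hx =>
    obtain ⟨f, hf, g, hg, rfl⟩ := hx
    have hq : ⁅f, g⁆ ∈ Subgroup.centralizer (unitarySetStar n) :=
      mul_mem (mul_mem (mul_mem hf hg) (inv_mem hf)) (inv_mem hg)
    obtain ⟨a, h, ha, -, hne, H⟩ := exists_scaling_of_mem_centralizer hn hf
    obtain ⟨b, k, hb, -, kne, K⟩ := exists_scaling_of_mem_centralizer hn hg
    obtain ⟨c, r, -, hr, rne, R⟩ := exists_scaling_of_mem_centralizer hn hq
    have key : ∀ p : WStarOpens n,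
        (c * (b * (a * (p : WSp n).1)), r (b * (a * (p : WSp n).1)) •
          k (a * (p : WSp n).1) • h (p : WSp n).1 • (p : WSp n).2) =
        (a * (b * (p : WSp n).1), h (b * (p : WSp n).1) • k (p : WSp n).1 • (p : WSp n).2) := by
      intro p
      have h1 : ⁅f, g⁆ * (g * f) = f * g := by
        rw [commutatorElement_def]
        group
      have h2 : (((⁅f, g⁆ : autCnStar n) : Equiv.Perm (WStarOpens n))
          ((g : Equiv.Perm (WStarOpens n)) ((f : Equiv.Perm (WStarOpens n)) p)) : WSp n) =
          (f : Equiv.Perm (WStarOpens n)) ((g : Equiv.Perm (WStarOpens n)) p) :=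
        congrArg (fun x : autCnStar n => ((x : Equiv.Perm (WStarOpens n)) p : WSp n)) h1
      rw [R, K, H, H, K] at h2
      exact h2
    have hc : c = 1 := by
      have h1 := congrArg Prod.fst
        (key ⟨(1, 0), fun h => one_ne_zero (congrArg Prod.fst h)⟩)
      simpa [ha, hb, mul_comm b a] using h1
    have hr0 : r 0 = 1 := by
      have h1 := congrFun (congrArg Prod.snd (key ⟨(0, Pi.single ⟨0, by omega⟩ 1), fun h => by
        simpa using congrFun (congrArg Prod.snd h) ⟨0, by omega⟩⟩)) ⟨0, by omega⟩
      simp only [mul_zero, Pi.smul_apply, Pi.single_eq_same, smul_eq_mul, mul_one] at h1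
      refine mul_right_cancel₀ (mul_ne_zero (kne 0) (hne 0)) ?_
      rw [h1]
      ring
    exact ⟨r, hr, rne, hr0, fun p => by rw [R, hc, one_mul]⟩
  | one => exact ⟨fun _ => 1, differentiable_const 1, fun _ => one_ne_zero, rfl, fun p => by simp⟩
  | mul x y _ _ hx hy =>
    obtain ⟨h, hd, hne, h0, H⟩ := hx
    obtain ⟨k, kd, kne, k0, K⟩ := hy
    refine ⟨fun z => h z * k z, hd.mul kd, fun z => mul_ne_zero (hne z) (kne z), by simp [h0, k0],
      fun p => ?_⟩
    change ((x : Equiv.Perm (WStarOpens n)) ((y : Equiv.Perm (WStarOpens n)) p) : WSp n) = _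
    rw [H, K, smul_smul]
  | inv x _ hx =>
    obtain ⟨h, hd, hne, h0, H⟩ := hx
    refine ⟨fun z => (h z)⁻¹, hd.inv hne, fun z => inv_ne_zero (hne z), by simp [h0],
      fun p => ?_⟩
    obtain ⟨q, rfl⟩ := (x : Equiv.Perm (WStarOpens n)).surjective p
    have h1 : ((x⁻¹ : autCnStar n) : Equiv.Perm (WStarOpens n))
      ((x : Equiv.Perm (WStarOpens n)) q) = q := Equiv.symm_apply_apply _ _
    rw [h1, H]
    simp [smul_smul, hne]

theorem mem_commutator_of_scaling {n : ℕ} {f : autCnStar n} {h : ℂ → ℂ}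
    (hd : Differentiable ℂ h) (hne : ∀ z, h z ≠ 0) (h0 : h 0 = 1)
    (hf : ∀ p : WStarOpens n, ((f : Equiv.Perm (WStarOpens n)) p : WSp n) =
      ((p : WSp n).1, h (p : WSp n).1 • (p : WSp n).2)) :
    f ∈ ⁅Subgroup.centralizer (unitarySetStar n), Subgroup.centralizer (unitarySetStar n)⁆ := by
  obtain ⟨k, kd, kne, hk⟩ := Complex.exists_comp_two_mul_eq_mul hd hne h0
  obtain ⟨s, hs⟩ := exists_autCnStar_scaling n (a := 2⁻¹) (by norm_num)
    (differentiable_const (1 : ℂ)) fun _ => one_ne_zero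
  obtain ⟨g, hg⟩ := exists_autCnStar_scaling n one_ne_zero kd kne
  have h1 : f * (g * s) = s * g := by
    refine autCnStar_ext fun p => ?_
    change ((f : Equiv.Perm (WStarOpens n))
      ((g : Equiv.Perm (WStarOpens n)) ((s : Equiv.Perm (WStarOpens n)) p)) : WSp n) =
      (s : Equiv.Perm (WStarOpens n)) ((g : Equiv.Perm (WStarOpens n)) p)
    rw [hf, hg, hs, hs, hg]
    have h2 := hk (2⁻¹ * (p : WSp n).1)
    rw [mul_inv_cancel_left₀ two_ne_zero] at h2
    simp [smul_smul, h2]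
  have h2 : f = ⁅s, g⁆ := by
    rw [commutatorElement_def, mul_assoc, ← _root_.mul_inv_rev, ← h1, mul_inv_cancel_right]
  rw [h2]
  exact Subgroup.commutator_mem_commutator (mem_centralizer_unitarySetStar_of_scaling (h := fun _ => 1) hs)
    (mem_centralizer_unitarySetStar_of_scaling hg)

/-- For `n ≥ 2`, let `C*` be the centralizer of `U_{n−1}` in
`Aut(ℂ^{n*})` (the group of all maps `(z₁,z') ↦ (a z₁, h(z₁) z')` with `a ≠ 0` and `h` a
nowhere-vanishing entire function).  Then the commutator subgroup of `C*` consists exactly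
of the maps `(z₁,z') ↦ (z₁, h(z₁) z')` with `h` a nowhere-vanishing entire function with
`h(0) = 1`; in particular the commutator subgroup of `C*` is abelian. -/
theorem commutator_of_centralizer_star_abelian {n : ℕ} (hn : 2 ≤ n) :
    (∀ f : autCnStar n,
      f ∈ ⁅Subgroup.centralizer (unitarySetStar n), Subgroup.centralizer (unitarySetStar n)⁆
        ↔ ∃ h : ℂ → ℂ, Differentiable ℂ h ∧ (∀ z, h z ≠ 0) ∧ h 0 = 1 ∧
            ∀ p : (WStarOpens n), (((f : Equiv.Perm (WStarOpens n)) p : WSp n)) =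
              ((p : WSp n).1, h (p : WSp n).1 • (p : WSp n).2)) ∧
    (∀ x ∈ ⁅Subgroup.centralizer (unitarySetStar n),
        Subgroup.centralizer (unitarySetStar n)⁆,
      ∀ y ∈ ⁅Subgroup.centralizer (unitarySetStar n),
        Subgroup.centralizer (unitarySetStar n)⁆, x * y = y * x) := by
  refine ⟨fun f => ⟨exists_scaling_of_mem_commutator hn, ?_⟩, fun x hx y hy => ?_⟩
  · rintro ⟨h, hd, hne, h0, hf⟩
    exact mem_commutator_of_scaling hd hne h0 hf
  · obtain ⟨h, -, -, -, hx⟩ := exists_scaling_of_mem_commutator hn hx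
    obtain ⟨k, -, -, -, hy⟩ := exists_scaling_of_mem_commutator hn hy
    refine autCnStar_ext fun p => ?_
    change ((x : Equiv.Perm (WStarOpens n)) ((y : Equiv.Perm (WStarOpens n)) p) : WSp n) =
      (y : Equiv.Perm (WStarOpens n)) ((x : Equiv.Perm (WStarOpens n)) p)
    rw [hx, hy, hy, hx]
    exact congrArg (Prod.mk _) (smul_comm _ _ _)

end
end
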